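/- Derivative of the genus-1 Virasoro conjecture along the quantum volume element: under the stated assumptions (WDVV, quasi-homogeneity, identity axiom, and Getzler's genus-1 equation G₀ + G₁ = 0), the vector field Δ annihilates Ψ, i.e. ΔΨ = 0 identically on ℂ^N, where Ψ := ⟨⟨E²⟩⟩₁ + (1/24)Σ_α ⟨⟨E E γ_α γ^α⟩⟩₀ − (1/2)Σ_α (b_α(1−b_α) − (b₁+1)/6) ⟨⟨γ_α γ^α⟩⟩₀ and E² := E∘E. -/

import Mathlib

open scoped BigOperators

/-- Points of the small phase space `ℂ^N`. -/
abbrev Pt (N : ℕ) := Fin N → ℂ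

/-- Vector fields on `ℂ^N` (components with respect to the basis `γ_α`). -/
abbrev VF (N : ℕ) := Pt N → Pt N

/-- Partial derivative `∂/∂t^α`. -/
noncomputable def pd {N : ℕ} (α : Fin N) (F : Pt N → ℂ) : Pt N → ℂ :=
  fun t => fderiv ℂ F t (Pi.single α 1)

/-- The `k`-point function `⟨⟨v₁ ⋯ v_k⟩⟩` associated with a generating function `F`. -/
noncomputable def corr {N : ℕ} : (Pt N → ℂ) → List (VF N) → Pt N → ℂ
  | F, [] => F
  | F, v :: vs => fun t => ∑ α, v t α * corr (pd α F) vs t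

/-- Constant vector field associated with an element of `ℂ^N`. -/
def cvf {N : ℕ} (x : Pt N) : VF N := fun _ => x

/-- The basis vector field `γ_α`. -/
noncomputable def bas {N : ℕ} (α : Fin N) : VF N := cvf (Pi.single α 1)

/-- The dual basis vector field `γ^α = η^{αβ} γ_β`. -/
noncomputable def dua {N : ℕ} (ηinv : Matrix (Fin N) (Fin N) ℂ) (α : Fin N) : VF N :=
  cvf (fun β => ηinv α β)

/-- The quantum product `v ∘ w := ⟨⟨v w γ^α⟩⟩₀ γ_α` of two vector fields. -/
noncomputable def qp {N : ℕ} (F : Pt N → ℂ) (ηinv : Matrix (Fin N) (Fin N) ℂ)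
    (v w : VF N) : VF N :=
  fun t σ => corr F [v, w, dua ηinv σ] t

/-- The grading operator `G(Σ f_α γ_α) = Σ b_α f_α γ_α`. -/
def Gop {N : ℕ} (b : Fin N → ℂ) (v : VF N) : VF N := fun t α => b α * v t α

/-- The Euler vector field `E = c + Σ_α (b₁ + 1 - b_α) t^α γ_α`. -/
def euler {N : ℕ} (c : Pt N) (b : Fin N → ℂ) (b1 : ℂ) : VF N :=
  fun t α => c α + (b1 + 1 - b α) * t α

/-- The quantum volume element `Δ := γ^α ∘ γ_α`. -/
noncomputable def qvol {N : ℕ} (F : Pt N → ℂ) (ηinv : Matrix (Fin N) (Fin N) ℂ) : VF N :=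
  fun t => ∑ α, qp F ηinv (dua ηinv α) (bas α) t

/-- Covariant derivative `∇_v w` with respect to the trivial connection (`∇ γ_α = 0`). -/
noncomputable def nablaVF {N : ℕ} (v w : VF N) : VF N :=
  fun t α => fderiv ℂ (fun s => w s α) t (v t)

/-- Derivative of a function along a vector field. -/
noncomputable def dirD {N : ℕ} (v : VF N) (f : Pt N → ℂ) : Pt N → ℂ :=
  fun t => fderiv ℂ f t (v t)

/-- Quantum powers of a vector field: `E⁰ := γ₁`, `E^{k+1} := E ∘ E^k`. -/
noncomputable def epow {N : ℕ} [NeZero N] (F : Pt N → ℂ) (ηinv : Matrix (Fin N) (Fin N) ℂ)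
    (E : VF N) : ℕ → VF N
  | 0 => bas 0
  | k + 1 => qp F ηinv E (epow F ηinv E k)

/-- The genus-0 part `G₀` of Getzler's equation. -/
noncomputable def G0func {N : ℕ} (F0 : Pt N → ℂ) (ηinv : Matrix (Fin N) (Fin N) ℂ)
    (v : Fin 4 → VF N) (t : Pt N) : ℂ :=
  ∑ g : Equiv.Perm (Fin 4),
    ((1/6) * ∑ α, corr F0 [v (g 0), v (g 1), v (g 2), dua ηinv α] t *
        (∑ β, corr F0 [bas α, v (g 3), bas β, dua ηinv β] t)
    + (1/24) * ∑ α, corr F0 [v (g 0), v (g 1), v (g 2), v (g 3), dua ηinv α] t *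
        (∑ β, corr F0 [bas α, bas β, dua ηinv β] t)
    - (1/4) * ∑ α, ∑ β, corr F0 [v (g 0), v (g 1), dua ηinv α, dua ηinv β] t *
        corr F0 [bas α, bas β, v (g 2), v (g 3)] t)

/-- The genus-1 part `G₁` of Getzler's equation. -/
noncomputable def G1func {N : ℕ} (F0 F1 : Pt N → ℂ) (ηinv : Matrix (Fin N) (Fin N) ℂ)
    (v : Fin 4 → VF N) (t : Pt N) : ℂ :=
  ∑ g : Equiv.Perm (Fin 4),
    (3 * corr F1 [qp F0 ηinv (v (g 0)) (v (g 1)), qp F0 ηinv (v (g 2)) (v (g 3))] t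
    - 4 * corr F1 [qp F0 ηinv (qp F0 ηinv (v (g 0)) (v (g 1))) (v (g 2)), v (g 3)] t
    - ∑ α, corr F0 [qp F0 ηinv (v (g 0)) (v (g 1)), v (g 2), v (g 3), dua ηinv α] t *
        corr F1 [bas α] t
    + 2 * ∑ α, corr F0 [v (g 0), v (g 1), v (g 2), dua ηinv α] t *
        corr F1 [qp F0 ηinv (bas α) (v (g 3))] t)

set_option maxRecDepth 10000 in
theorem map_univ_perm_fin_four :
    (Finset.univ : Finset (Equiv.Perm (Fin 4))).val.map (fun g => (g 0, g 1, g 2, g 3)) =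
      {(0, 1, 2, 3), (0, 1, 3, 2), (0, 2, 1, 3), (0, 2, 3, 1), (0, 3, 1, 2), (0, 3, 2, 1),
       (1, 0, 2, 3), (1, 0, 3, 2), (1, 2, 0, 3), (1, 2, 3, 0), (1, 3, 0, 2), (1, 3, 2, 0),
       (2, 0, 1, 3), (2, 0, 3, 1), (2, 1, 0, 3), (2, 1, 3, 0), (2, 3, 0, 1), (2, 3, 1, 0),
       (3, 0, 1, 2), (3, 0, 2, 1), (3, 1, 0, 2), (3, 1, 2, 0), (3, 2, 0, 1), (3, 2, 1, 0)} := by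
  decide +kernel

theorem sum_perm_fin_four {M : Type*} [AddCommMonoid M] (φ : Fin 4 → Fin 4 → Fin 4 → Fin 4 → M) :
    ∑ g : Equiv.Perm (Fin 4), φ (g 0) (g 1) (g 2) (g 3) =
      (φ 0 1 2 3 + φ 0 1 3 2 + φ 0 2 1 3 + φ 0 2 3 1 + φ 0 3 1 2 + φ 0 3 2 1) +
      (φ 1 0 2 3 + φ 1 0 3 2 + φ 1 2 0 3 + φ 1 2 3 0 + φ 1 3 0 2 + φ 1 3 2 0) +
      (φ 2 0 1 3 + φ 2 0 3 1 + φ 2 1 0 3 + φ 2 1 3 0 + φ 2 3 0 1 + φ 2 3 1 0) +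
      (φ 3 0 1 2 + φ 3 0 2 1 + φ 3 1 0 2 + φ 3 1 2 0 + φ 3 2 0 1 + φ 3 2 1 0) := by
  have h := congrArg (fun s => (s.map fun p => φ p.1 p.2.1 p.2.2.1 p.2.2.2).sum)
    map_univ_perm_fin_four
  simp only [Multiset.map_map, Function.comp_def] at h
  rw [Finset.sum, h]
  simp [add_assoc]

section Pointwise
variable {N : ℕ} {ηinv : Matrix (Fin N) (Fin N) ℂ}

theorem sum_dual_symm {W : Type*} [AddCommGroup W] [Module ℂ W] (hη : ηinv.IsSymm)
    (B : Pt N →ₗ[ℂ] Pt N →ₗ[ℂ] W) :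
    ∑ α, B (ηinv α) (Pi.single α 1) = ∑ α, B (Pi.single α 1) (ηinv α) := by
  have h : ∀ α, ηinv α = ∑ β, ηinv α β • (Pi.single β 1 : Pt N) := fun α =>
    pi_eq_sum_univ' (ηinv α)
  conv_lhs => enter [2, α]; rw [h]
  conv_rhs => enter [2, α]; rw [h]
  simp only [map_sum, map_smul, LinearMap.sum_apply, LinearMap.smul_apply]
  rw [Finset.sum_comm]
  simp only [hη.apply]

theorem sum_dual_mul_symm (hη : ηinv.IsSymm) (f g : Pt N →ₗ[ℂ] ℂ) :
    ∑ α, f (ηinv α) * g (Pi.single α 1) = ∑ α, f (Pi.single α 1) * g (ηinv α) := by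
  simpa using sum_dual_symm hη ((LinearMap.mul ℂ ℂ).compl₁₂ f g)

theorem sum_dual_smul (hη : ηinv.IsSymm) {W : Type*} [AddCommGroup W] [Module ℂ W]
    (f : Pt N →ₗ[ℂ] ℂ) (g : Pt N →ₗ[ℂ] W) :
    ∑ α, f (ηinv α) • g (Pi.single α 1) = ∑ α, f (Pi.single α 1) • g (ηinv α) := by
  simpa using sum_dual_symm hη ((LinearMap.lsmul ℂ W).compl₁₂ f g)

/-- Raising the index of a linear form. -/
def raise (ηinv : Matrix (Fin N) (Fin N) ℂ) : (Pt N →ₗ[ℂ] ℂ) →ₗ[ℂ] Pt N where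
  toFun φ σ := φ (ηinv σ)
  map_add' _ _ := rfl
  map_smul' _ _ := rfl

theorem map_raise {W : Type*} [AddCommGroup W] [Module ℂ W] (φ : Pt N →ₗ[ℂ] ℂ)
    (g : Pt N →ₗ[ℂ] W) : g (raise ηinv φ) = ∑ σ, φ (ηinv σ) • g (Pi.single σ 1) := by
  conv_lhs => rw [pi_eq_sum_univ' (raise ηinv φ)]
  simp [raise]

/-- The value at a point of the tensors entering Getzler's equation. -/
structure GWPoint (N : ℕ) where
  ηm : Matrix (Fin N) (Fin N) ℂ
  ηinv : Matrix (Fin N) (Fin N) ℂ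
  η_symm : ηinv.IsSymm
  η_mul : ηm * ηinv = 1
  b : Fin N → ℂ
  b1 : ℂ
  b_add : ∀ α β, ηinv α β ≠ 0 → b α + b β = 1
  c3 : Pt N →ₗ[ℂ] Pt N →ₗ[ℂ] Pt N →ₗ[ℂ] ℂ
  c4 : Pt N →ₗ[ℂ] Pt N →ₗ[ℂ] Pt N →ₗ[ℂ] Pt N →ₗ[ℂ] ℂ
  c5 : Pt N →ₗ[ℂ] Pt N →ₗ[ℂ] Pt N →ₗ[ℂ] Pt N →ₗ[ℂ] Pt N →ₗ[ℂ] ℂ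
  f1 : Pt N →ₗ[ℂ] ℂ
  f2 : Pt N →ₗ[ℂ] Pt N →ₗ[ℂ] ℂ
  E : Pt N
  c3_12 : ∀ u v w, c3 u v w = c3 v u w
  c3_23 : ∀ u v w, c3 u v w = c3 u w v
  c4_12 : ∀ u v w x, c4 u v w x = c4 v u w x
  c4_23 : ∀ u v w x, c4 u v w x = c4 u w v x
  c4_34 : ∀ u v w x, c4 u v w x = c4 u v x w
  c5_12 : ∀ u v w x y, c5 u v w x y = c5 v u w x y
  c5_23 : ∀ u v w x y, c5 u v w x y = c5 u w v x y
  c5_34 : ∀ u v w x y, c5 u v w x y = c5 u v x w y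
  f2_12 : ∀ u v, f2 u v = f2 v u
  assoc : ∀ u v w, raise ηinv (c3 (raise ηinv (c3 u v)) w) =
    raise ηinv (c3 u (raise ηinv (c3 v w)))
  assoc_deriv : ∀ x u v w,
    raise ηinv (c4 x (raise ηinv (c3 u v)) w) + raise ηinv (c3 (raise ηinv (c4 x u v)) w) =
    raise ηinv (c4 x u (raise ηinv (c3 v w))) + raise ηinv (c3 u (raise ηinv (c4 x v w)))
  c4_E : ∀ u v w, c4 E u v w = c3 (fun α => b α * u α) v w + c3 u (fun α => b α * v α) w +
    c3 u v (fun α => b α * w α) - (b1 + 1) * c3 u v w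
  f2_E : ∀ v, f2 E v = f1 (fun α => b α * v α) - (b1 + 1) * f1 v

namespace GWPoint
variable (P : GWPoint N)

/-- The dual basis. -/
def δ (α : Fin N) : Pt N := P.ηinv α

/-- The basis. -/
def γ (_ : GWPoint N) (α : Fin N) : Pt N := Pi.single α 1

/-- The quantum product. -/
def m : Pt N →ₗ[ℂ] Pt N →ₗ[ℂ] Pt N := P.c3.compr₂ (raise P.ηinv)

/-- The four-point function with one index raised. -/
def D (x : Pt N) : Pt N →ₗ[ℂ] Pt N →ₗ[ℂ] Pt N := (P.c4 x).compr₂ (raise P.ηinv)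

/-- The grading operator. -/
def G : Pt N →ₗ[ℂ] Pt N where
  toFun u α := P.b α * u α
  map_add' u v := by ext; simp [mul_add]
  map_smul' u v := by ext; simp [mul_left_comm]

theorem m_coord (u v : Pt N) (σ : Fin N) : P.m u v σ = P.c3 u v (P.δ σ) := rfl
theorem D_coord (u v w : Pt N) (σ : Fin N) : P.D u v w σ = P.c4 u v w (P.δ σ) := rfl

theorem m_comm (u v : Pt N) : P.m u v = P.m v u := by
  ext σ; simp only [m_coord]; rw [P.c3_12]

theorem m_assoc (u v w : Pt N) : P.m (P.m u v) w = P.m u (P.m v w) := P.assoc u v w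

theorem m_left_comm (u v w : Pt N) : P.m u (P.m v w) = P.m v (P.m u w) := by
  rw [← m_assoc, P.m_comm u v, m_assoc]

theorem D_12 (u v w : Pt N) : P.D u v w = P.D v u w := by
  ext σ; simp only [D_coord]; rw [P.c4_12]

theorem D_23 (u v w : Pt N) : P.D u v w = P.D u w v := by
  ext σ; simp only [D_coord]; rw [P.c4_23]

theorem D_m (x u v w : Pt N) :
    P.D x (P.m u v) w + P.m (P.D x u v) w = P.D x u (P.m v w) + P.m u (P.D x v w) :=
  P.assoc_deriv x u v w

theorem G_δ (α : Fin N) : P.G (P.δ α) = (1 - P.b α) • P.δ α := by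
  ext β
  simp only [G, δ, LinearMap.coe_mk, AddHom.coe_mk, Pi.smul_apply, smul_eq_mul]
  by_cases h : P.ηinv α β = 0
  · simp [h]
  · linear_combination P.ηinv α β * P.b_add α β h

theorem G_γ (α : Fin N) : P.G (P.γ α) = P.b α • P.γ α := by
  ext β
  by_cases h : β = α
  · subst h; simp [G, γ]
  · simp [G, γ, h]

variable {W : Type*} [AddCommGroup W] [Module ℂ W]

theorem sum_symm (B : Pt N →ₗ[ℂ] Pt N →ₗ[ℂ] W) :
    ∑ α, B (P.δ α) (P.γ α) = ∑ α, B (P.γ α) (P.δ α) := sum_dual_symm P.η_symm B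

theorem sum_mul_symm (f g : Pt N →ₗ[ℂ] ℂ) :
    ∑ α, f (P.δ α) * g (P.γ α) = ∑ α, f (P.γ α) * g (P.δ α) :=
  sum_dual_mul_symm P.η_symm f g

theorem map_m (u v : Pt N) (g : Pt N →ₗ[ℂ] W) :
    g (P.m u v) = ∑ σ, P.c3 u v (P.δ σ) • g (P.γ σ) := map_raise _ g

theorem map_D (u v w : Pt N) (g : Pt N →ₗ[ℂ] W) :
    g (P.D u v w) = ∑ σ, P.c4 u v w (P.δ σ) • g (P.γ σ) := map_raise _ g

theorem sum_m (u : Pt N) (B : Pt N →ₗ[ℂ] Pt N →ₗ[ℂ] W) :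
    ∑ α, B (P.m u (P.δ α)) (P.γ α) = ∑ α, B (P.δ α) (P.m u (P.γ α)) := by
  have h1 : ∀ α, B (P.m u (P.δ α)) (P.γ α) =
      ∑ σ, P.c3 u (P.δ α) (P.δ σ) • B (P.γ σ) (P.γ α) := fun α =>
    P.map_m u (P.δ α) (B.flip (P.γ α))
  have h2 : ∀ α, B (P.δ α) (P.m u (P.γ α)) =
      ∑ σ, P.c3 u (P.γ α) (P.δ σ) • B (P.δ α) (P.γ σ) := fun α => P.map_m u (P.γ α) (B (P.δ α))
  simp only [h1, h2]
  rw [Finset.sum_comm]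
  conv_rhs => rw [Finset.sum_comm]
  have h3 : ∀ σ, ∑ α, P.c3 u (P.γ α) (P.δ σ) • B (P.δ α) (P.γ σ) =
      ∑ α, P.c3 u (P.δ α) (P.δ σ) • B (P.γ α) (P.γ σ) := fun σ =>
    (sum_dual_smul P.η_symm ((P.c3 u).flip (P.δ σ)) (B.flip (P.γ σ))).symm
  simp only [h3]
  rw [Finset.sum_comm]
  refine Finset.sum_congr rfl fun α _ => Finset.sum_congr rfl fun σ _ => ?_
  rw [P.c3_23]

theorem sum_G (B : Pt N →ₗ[ℂ] Pt N →ₗ[ℂ] W) (hB : ∀ x y, B x y = B y x) :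
    ∑ α, B (P.G (P.δ α)) (P.γ α) = (1 / 2 : ℂ) • ∑ α, B (P.δ α) (P.γ α) := by
  have h1 : ∑ α, B (P.G (P.δ α)) (P.γ α) =
      ∑ α, B (P.δ α) (P.γ α) - ∑ α, B (P.δ α) (P.G (P.γ α)) := by
    rw [← Finset.sum_sub_distrib]
    refine Finset.sum_congr rfl fun α _ => ?_
    rw [G_δ, G_γ, map_smul, map_smul, LinearMap.smul_apply, sub_smul, one_smul]
  have h2 : ∑ α, B (P.δ α) (P.G (P.γ α)) = ∑ α, B (P.G (P.δ α)) (P.γ α) := by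
    have := P.sum_symm (B.comp P.G)
    simp only [LinearMap.comp_apply] at this
    rw [this]
    exact Finset.sum_congr rfl fun α _ => hB _ _
  rw [h2] at h1
  rw [eq_sub_iff_add_eq, ← two_smul ℂ] at h1
  rw [← h1, smul_smul]; norm_num

/-- The quantum volume element. -/
def Δ : Pt N := ∑ α, P.m (P.δ α) (P.γ α)

theorem sum_m_G : ∑ α, P.m (P.G (P.δ α)) (P.γ α) = (1 / 2 : ℂ) • P.Δ :=
  P.sum_G P.m P.m_comm

theorem sum_m_G' : ∑ α, P.m (P.δ α) (P.G (P.γ α)) = (1 / 2 : ℂ) • P.Δ := by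
  rw [← sum_m_G]
  have := P.sum_symm (P.m.comp P.G)
  simp only [LinearMap.comp_apply] at this
  rw [this]
  exact Finset.sum_congr rfl fun α _ => P.m_comm _ _

theorem sum_m_G_m (u : Pt N) :
    ∑ α, P.m (P.G (P.m u (P.δ α))) (P.γ α) = (1 / 2 : ℂ) • P.m u P.Δ := by
  have h := P.sum_m u (P.m.comp P.G)
  simp only [LinearMap.comp_apply] at h
  rw [h, ← map_smul, ← sum_m_G, map_sum]
  exact Finset.sum_congr rfl fun α _ => P.m_left_comm _ _ _

theorem D_E (u v : Pt N) : P.D P.E u v =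
    P.m (P.G u) v + P.m u (P.G v) - P.G (P.m u v) - P.b1 • P.m u v := by
  ext σ
  have h := P.c4_E u v (P.δ σ)
  change P.c4 P.E u v (P.δ σ) = P.c3 (P.G u) v (P.δ σ) + P.c3 u (P.G v) (P.δ σ) +
    P.c3 u v (P.G (P.δ σ)) - _ at h
  rw [D_coord, h, G_δ, map_smul]
  simp only [Pi.sub_apply, Pi.add_apply, Pi.smul_apply, m_coord, smul_eq_mul]
  simp only [G, LinearMap.coe_mk, AddHom.coe_mk, m_coord]
  ring

/-- The genus-one part of Getzler's equation at a point. -/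
def genusOne (v : Fin 4 → Pt N) : ℂ :=
  ∑ g : Equiv.Perm (Fin 4),
    (3 * P.f2 (P.m (v (g 0)) (v (g 1))) (P.m (v (g 2)) (v (g 3)))
    - 4 * P.f2 (P.m (P.m (v (g 0)) (v (g 1))) (v (g 2))) (v (g 3))
    - P.f1 (P.D (P.m (v (g 0)) (v (g 1))) (v (g 2)) (v (g 3)))
    + 2 * P.f1 (P.m (P.D (v (g 0)) (v (g 1)) (v (g 2))) (v (g 3))))

theorem genusOne_eq (e x y : Pt N) : P.genusOne ![e, e, x, y] =
    24 * P.f2 (P.m e e) (P.m x y) + 48 * P.f2 (P.m e x) (P.m e y)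
    - 48 * P.f2 (P.m e (P.m x y)) e - 24 * P.f2 (P.m e (P.m e x)) y
    - 24 * P.f2 (P.m e (P.m e y)) x
    - 4 * P.f1 (P.D (P.m e e) x y) - 4 * P.f1 (P.D (P.m x y) e e)
    - 8 * P.f1 (P.D (P.m e x) y e) - 8 * P.f1 (P.D (P.m e y) x e)
    + 24 * P.f1 (P.m e (P.D e x y)) + 12 * P.f1 (P.m (P.D e e x) y)
    + 12 * P.f1 (P.m (P.D e e y) x) := by
  unfold genusOne
  rw [sum_perm_fin_four (fun i j k l =>
    3 * P.f2 (P.m (![e, e, x, y] i) (![e, e, x, y] j)) (P.m (![e, e, x, y] k) (![e, e, x, y] l))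
    - 4 * P.f2 (P.m (P.m (![e, e, x, y] i) (![e, e, x, y] j)) (![e, e, x, y] k)) (![e, e, x, y] l)
    - P.f1 (P.D (P.m (![e, e, x, y] i) (![e, e, x, y] j)) (![e, e, x, y] k) (![e, e, x, y] l))
    + 2 * P.f1 (P.m (P.D (![e, e, x, y] i) (![e, e, x, y] j) (![e, e, x, y] k))
      (![e, e, x, y] l)))]
  simp only [Matrix.cons_val]
  simp only [P.m_comm y x, P.m_comm x e, P.m_comm y e, P.m_assoc, P.m_left_comm x e, P.D_23 e e x,
    P.D_23 e e y, P.D_23 (P.m e x) e y,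
    P.D_23 (P.m e y) e x, P.D_23 x y e, P.D_23 _ y x, P.D_12 x e, P.D_12 y e,
    P.D_12 y x, P.f2_12 (P.m x y) (P.m e e), P.f2_12 (P.m e y) (P.m e x)]
  simp only [P.m_comm _ (P.D _ _ _)]
  ring

theorem sum_D_E : ∑ α, P.D P.E (P.δ α) (P.γ α) = (1 - P.b1) • P.Δ - P.G P.Δ := by
  simp only [D_E, Finset.sum_add_distrib, Finset.sum_sub_distrib, ← Finset.smul_sum, ← map_sum]
  rw [sum_m_G, sum_m_G']
  change _ + _ - P.G P.Δ - P.b1 • P.Δ = _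
  module

theorem sum_D_E_m : ∑ α, P.D P.E (P.m P.E (P.δ α)) (P.γ α) =
    (1 - P.b1) • P.m P.E P.Δ - P.G (P.m P.E P.Δ) := by
  have h : ∑ α, P.m (P.m P.E (P.δ α)) (P.γ α) = P.m P.E P.Δ := by
    simp only [m_assoc, ← map_sum, Δ]
  have h' : ∑ α, P.m (P.m P.E (P.δ α)) (P.G (P.γ α)) = (1 / 2 : ℂ) • P.m P.E P.Δ := by
    simp only [m_assoc, ← map_sum, sum_m_G', map_smul]
  simp only [D_E, Finset.sum_add_distrib, Finset.sum_sub_distrib, ← Finset.smul_sum, ← map_sum]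
  rw [sum_m_G_m, h, h']
  module

theorem sum_m_D_E : ∑ α, P.m (P.D P.E P.E (P.δ α)) (P.γ α) =
    P.m (P.G P.E) P.Δ - P.b1 • P.m P.E P.Δ := by
  have h (u : Pt N) : ∑ α, P.m (P.m u (P.δ α)) (P.γ α) = P.m u P.Δ := by
    simp only [m_assoc, ← map_sum, Δ]
  have h' : ∑ α, P.m (P.m P.E (P.G (P.δ α))) (P.γ α) = (1 / 2 : ℂ) • P.m P.E P.Δ := by
    simp only [m_assoc, ← map_sum, sum_m_G, map_smul]
  simp only [D_E, map_add, map_sub, map_smul, LinearMap.add_apply, LinearMap.sub_apply,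
    LinearMap.smul_apply, Finset.sum_add_distrib, Finset.sum_sub_distrib, ← Finset.smul_sum]
  rw [h, h, h', sum_m_G_m]
  module

theorem sum_m_D_E' : ∑ α, P.m (P.D P.E P.E (P.γ α)) (P.δ α) =
    P.m (P.G P.E) P.Δ - P.b1 • P.m P.E P.Δ := by
  rw [← sum_m_D_E]
  exact (P.sum_symm (P.m.comp (P.D P.E P.E))).symm

theorem sum_D_sq : ∑ α, P.D (P.m P.E P.E) (P.δ α) (P.γ α) =
    (2 - P.b1) • P.m P.E P.Δ - P.G (P.m P.E P.Δ) - P.m P.E (P.G P.Δ) - P.m (P.G P.E) P.Δ := by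
  have h : ∀ α, P.D (P.m P.E P.E) (P.δ α) (P.γ α) = P.D P.E (P.m P.E (P.δ α)) (P.γ α)
      + P.m P.E (P.D P.E (P.δ α) (P.γ α)) - P.m (P.D P.E P.E (P.γ α)) (P.δ α) := by
    intro α
    have h := P.D_m (P.γ α) P.E P.E (P.δ α)
    rw [P.D_12 _ (P.m P.E P.E), P.D_23 _ (P.γ α) (P.δ α), P.D_12 (P.γ α) P.E (P.m _ _),
      P.D_23 P.E (P.γ α), P.D_12 (P.γ α) P.E (P.δ α), P.D_23 P.E (P.γ α) (P.δ α),
      P.D_12 (P.γ α) P.E P.E, P.D_23 P.E (P.γ α) P.E] at h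
    exact eq_sub_of_add_eq h
  simp only [h, Finset.sum_add_distrib, Finset.sum_sub_distrib, ← map_sum]
  rw [sum_D_E_m, sum_D_E, sum_m_D_E']
  simp only [map_sub, map_smul]
  module

theorem sum_genusOne : ∑ α, P.genusOne ![P.E, P.E, P.δ α, P.γ α] =
    24 * (P.f2 (P.m P.E P.E) P.Δ + P.f1 (P.D P.E P.E P.Δ +
      (2 : ℂ) • P.m ((P.b1 + 1) • P.Δ - P.G P.Δ) P.E)) := by
  have h1 : ∑ α, P.f2 (P.m P.E (P.m P.E (P.δ α))) (P.γ α) =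
      ∑ α, P.f2 (P.m P.E (P.δ α)) (P.m P.E (P.γ α)) := P.sum_m P.E (P.f2.comp (P.m P.E))
  have h2 : ∑ α, P.f2 (P.m P.E (P.m P.E (P.γ α))) (P.δ α) =
      ∑ α, P.f2 (P.m P.E (P.m P.E (P.δ α))) (P.γ α) :=
    (P.sum_symm (P.f2.comp ((P.m P.E).comp (P.m P.E)))).symm
  have h3 : ∑ α, P.f1 (P.D (P.m P.E (P.δ α)) (P.γ α) P.E) =
      P.f1 (∑ α, P.D P.E (P.m P.E (P.δ α)) (P.γ α)) := by
    rw [map_sum]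
    refine Finset.sum_congr rfl fun α _ => ?_
    rw [P.D_23, P.D_12]
  have h4 : ∑ α, P.f1 (P.D (P.m P.E (P.γ α)) (P.δ α) P.E) =
      P.f1 (∑ α, P.D P.E (P.m P.E (P.δ α)) (P.γ α)) := by
    have h := P.sum_symm ((P.D P.E).comp (P.m P.E))
    simp only [LinearMap.comp_apply] at h
    rw [h, map_sum]
    refine Finset.sum_congr rfl fun α _ => ?_
    rw [P.D_23, P.D_12]
  have h5 : ∑ α, P.f1 (P.D (P.m (P.δ α) (P.γ α)) P.E P.E) = P.f1 (P.D P.E P.E P.Δ) := by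
    rw [Δ, map_sum, map_sum]
    refine Finset.sum_congr rfl fun α _ => ?_
    rw [P.D_12, P.D_23]
  have h6 : P.f2 (P.m P.E P.Δ) P.E = P.f1 (P.G (P.m P.E P.Δ)) - (P.b1 + 1) * P.f1 (P.m P.E P.Δ) := by
    rw [P.f2_12]; exact P.f2_E _
  have h7 : ∑ α, P.f2 (P.m P.E (P.m (P.δ α) (P.γ α))) P.E =
      P.f1 (P.G (P.m P.E P.Δ)) - (P.b1 + 1) * P.f1 (P.m P.E P.Δ) := by
    rw [← h6, Δ, map_sum, map_sum, LinearMap.sum_apply]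
  simp only [genusOne_eq, Finset.sum_add_distrib, Finset.sum_sub_distrib, ← Finset.mul_sum,
    h1, h2, h3, h4, h5, h7]
  simp only [← map_sum]
  rw [sum_D_sq, sum_D_E, sum_D_E_m, sum_m_D_E, sum_m_D_E']
  rw [← Δ, D_E]
  simp only [map_add, map_sub, map_smul, LinearMap.sub_apply,
    LinearMap.smul_apply, smul_eq_mul, P.m_comm P.Δ, P.m_comm (P.G P.Δ)]
  ring

theorem ext_δ {f g : Pt N →ₗ[ℂ] ℂ} (h : ∀ σ, f (P.δ σ) = g (P.δ σ)) : f = g := by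
  have hs : ∀ τ, P.γ τ = ∑ σ, P.ηm τ σ • P.δ σ := by
    intro τ
    ext ρ
    have := congrFun (congrFun P.η_mul τ) ρ
    rw [Matrix.mul_apply, Matrix.one_apply] at this
    simp [γ, δ, this, Pi.single_apply, eq_comm]
  refine LinearMap.pi_ext' fun τ => LinearMap.ext_ring ?_
  change f (P.γ τ) = g (P.γ τ)
  simp [hs, h]

theorem sum_c3_m (x y : Pt N) : ∑ β, P.c3 (P.m x (P.δ β)) (P.γ β) y = P.c3 x P.Δ y := by
  have h : ∑ β, P.c3 (P.m x (P.δ β)) (P.γ β) = P.c3 x P.Δ := by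
    refine P.ext_δ fun σ => ?_
    rw [LinearMap.sum_apply]
    simp only [← m_coord]
    rw [← Finset.sum_apply]
    simp only [m_assoc, ← map_sum, Δ]
  simpa using congrArg (fun f => f y) h

theorem sum_c3_m_G (x y : Pt N) :
    ∑ β, P.c3 (P.m x (P.δ β)) (P.G (P.γ β)) y = 1 / 2 * P.c3 x P.Δ y := by
  have h : ∑ β, P.c3 (P.m x (P.δ β)) (P.G (P.γ β)) = (1 / 2 : ℂ) • P.c3 x P.Δ := by
    refine P.ext_δ fun σ => ?_
    rw [LinearMap.sum_apply, LinearMap.smul_apply]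
    simp only [← m_coord]
    rw [← Finset.sum_apply]
    simp only [m_assoc, ← map_sum, sum_m_G', map_smul, Pi.smul_apply]
  simpa using congrArg (fun f => f y) h

/-- The summand of the squared norm of the three-point tensor. -/
def w (α β μ : Fin N) : ℂ :=
  P.c3 (P.δ α) (P.δ β) (P.δ μ) * P.c3 (P.γ α) (P.γ β) (P.γ μ)

theorem w_12 (α β μ : Fin N) : P.w α β μ = P.w β α μ := by
  rw [w, w, P.c3_12, P.c3_12 (P.γ α)]

theorem w_23 (α β μ : Fin N) : P.w α β μ = P.w α μ β := by
  rw [w, w, P.c3_23, P.c3_23 (P.γ α)]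

theorem sum_w (α β : Fin N) : ∑ μ, P.w α β μ = P.c3 (P.m (P.δ α) (P.δ β)) (P.γ β) (P.γ α) := by
  have := P.map_m (P.δ α) (P.δ β) (P.c3 (P.γ α) (P.γ β))
  rw [P.c3_12, P.c3_23, P.c3_12]
  simpa [w] using this.symm

/-- The squared norm of the quantum volume element. -/
def V : ℂ := ∑ α, P.c3 (P.δ α) (P.γ α) P.Δ

/-- The second moment of the grading on the three-point tensor. -/
def V2 : ℂ := ∑ α, P.b α ^ 2 * P.c3 (P.δ α) (P.γ α) P.Δ

theorem sum_sum_w (α : Fin N) : ∑ β, ∑ μ, P.w α β μ = P.c3 (P.δ α) (P.γ α) P.Δ := by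
  simp only [sum_w, sum_c3_m]
  rw [P.c3_23]

theorem sum_sum_b_w (α : Fin N) :
    ∑ β, ∑ μ, P.b β * P.w α β μ = 1 / 2 * P.c3 (P.δ α) (P.γ α) P.Δ := by
  simp only [← Finset.mul_sum, sum_w]
  rw [P.c3_23, ← sum_c3_m_G]
  refine Finset.sum_congr rfl fun β _ => ?_
  rw [G_γ, map_smul, LinearMap.smul_apply, smul_eq_mul]

theorem sum_c3_G (z : Pt N) :
    ∑ α, P.c3 (P.G (P.δ α)) (P.γ α) z = 1 / 2 * ∑ α, P.c3 (P.δ α) (P.γ α) z := by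
  simpa using P.sum_G (P.c3.compr₂ (LinearMap.applyₗ z)) fun x y => by
    simpa using P.c3_12 x y z

theorem sum_b_c3 (z : Pt N) :
    ∑ α, P.b α * P.c3 (P.δ α) (P.γ α) z = 1 / 2 * ∑ α, P.c3 (P.δ α) (P.γ α) z := by
  have h := P.sum_c3_G z
  simp only [G_δ, map_smul, LinearMap.smul_apply, smul_eq_mul, sub_mul, one_mul,
    Finset.sum_sub_distrib] at h
  linear_combination -h

theorem sum_moments (k : ℂ) : ∑ α, ∑ β, ∑ μ,
    (3 - P.b α - P.b β - P.b μ - k) * (P.b α + P.b β + P.b μ - k) * P.w α β μ =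
    (3 - 3 * k + k ^ 2) * P.V - 3 * P.V2 := by
  have swap12 (f : Fin N → Fin N → Fin N → ℂ) : ∑ α, ∑ β, ∑ μ, f β α μ * P.w α β μ =
      ∑ α, ∑ β, ∑ μ, f α β μ * P.w α β μ := by
    rw [Finset.sum_comm]
    simp only [P.w_12]
  have swap23 (f : Fin N → Fin N → Fin N → ℂ) : ∑ α, ∑ β, ∑ μ, f α μ β * P.w α β μ =
      ∑ α, ∑ β, ∑ μ, f α β μ * P.w α β μ := by
    refine Finset.sum_congr rfl fun α _ => ?_
    rw [Finset.sum_comm]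
    simp only [P.w_23 α]
  have h0 : ∑ α, ∑ β, ∑ μ, P.w α β μ = P.V := by simp only [sum_sum_w, V]
  have h1 : ∑ α, ∑ β, ∑ μ, P.b α * P.w α β μ = 1 / 2 * P.V := by
    simp only [← Finset.mul_sum, sum_sum_w, sum_b_c3, V]
  have h2 : ∑ α, ∑ β, ∑ μ, P.b α ^ 2 * P.w α β μ = P.V2 := by
    simp only [← Finset.mul_sum, sum_sum_w, V2]
  have h11 : ∑ α, ∑ β, ∑ μ, P.b α * P.b β * P.w α β μ = 1 / 4 * P.V := by
    have : ∀ α, ∑ β, ∑ μ, P.b α * P.b β * P.w α β μ =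
        P.b α * (1 / 2 * P.c3 (P.δ α) (P.γ α) P.Δ) := fun α => by
      rw [← sum_sum_b_w]; simp only [Finset.mul_sum, mul_assoc]
    rw [Finset.sum_congr rfl fun α _ => this α]
    simp only [mul_left_comm _ (1 / 2 : ℂ), ← Finset.mul_sum, sum_b_c3, V]
    ring
  have e1 := swap12 fun α _ _ => P.b α
  have e2 := swap23 fun _ β _ => P.b β
  have q1 := swap12 fun α _ _ => P.b α ^ 2
  have q2 := swap23 fun _ β _ => P.b β ^ 2
  have c1 := swap23 fun α β _ => P.b α * P.b β
  have c2 := swap12 fun α _ μ => P.b α * P.b μ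
  have : ∀ α β μ, (3 - P.b α - P.b β - P.b μ - k) * (P.b α + P.b β + P.b μ - k) * P.w α β μ =
      3 * (P.b α * P.w α β μ) + 3 * (P.b β * P.w α β μ) + 3 * (P.b μ * P.w α β μ)
      - P.b α ^ 2 * P.w α β μ - P.b β ^ 2 * P.w α β μ - P.b μ ^ 2 * P.w α β μ
      - 2 * (P.b α * P.b β * P.w α β μ) - 2 * (P.b α * P.b μ * P.w α β μ)
      - 2 * (P.b β * P.b μ * P.w α β μ) + (k ^ 2 - 3 * k) * P.w α β μ := fun α β μ => by ring
  simp only [this, Finset.sum_add_distrib, Finset.sum_sub_distrib, ← Finset.mul_sum]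
  simp only [← Finset.mul_sum] at h0 h1 h2 h11 e1 e2 q1 q2 c1 c2
  linear_combination (k ^ 2 - 3 * k) * h0 + 9 * h1 - 3 * h2 - 6 * h11 + 6 * e1 + 3 * e2 - 2 * q1 - q2
   - 4 * c1 - 2 * c2

/-- The contraction of the four-point function with the dual bases in the last two slots. -/
def K (x y : Pt N) : ℂ := ∑ β, P.c4 x y (P.γ β) (P.δ β)

/-- The double contraction of two four-point functions. -/
def H (x y z t : Pt N) : ℂ :=
  ∑ α, ∑ β, P.c4 x y (P.δ α) (P.δ β) * P.c4 (P.γ α) (P.γ β) z t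

theorem sum_H : ∑ α, P.H P.E (P.δ α) P.E (P.γ α) =
    (3 - 3 * (P.b1 + 1) + (P.b1 + 1) ^ 2) * P.V - 3 * P.V2 := by
  rw [← sum_moments]
  refine Finset.sum_congr rfl fun α _ => Finset.sum_congr rfl fun β _ =>
    Finset.sum_congr rfl fun μ _ => ?_
  have h1 : P.c4 P.E (P.δ α) (P.δ β) (P.δ μ) = _ := P.c4_E _ _ _
  have h2 : P.c4 P.E (P.γ α) (P.γ β) (P.γ μ) = _ := P.c4_E _ _ _
  change _ = P.c3 (P.G (P.δ α)) _ _ + P.c3 _ (P.G (P.δ β)) _ + P.c3 _ _ (P.G (P.δ μ)) - _ at h1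
  change _ = P.c3 (P.G (P.γ α)) _ _ + P.c3 _ (P.G (P.γ β)) _ + P.c3 _ _ (P.G (P.γ μ)) - _ at h2
  simp only [G_δ, G_γ, map_smul, LinearMap.smul_apply, smul_eq_mul] at h1 h2
  have h3 : P.c4 (P.γ β) (P.γ μ) P.E (P.γ α) = P.c4 P.E (P.γ α) (P.γ β) (P.γ μ) := by
    rw [P.c4_23, P.c4_12, P.c4_34, P.c4_23]
  rw [h3, h1, h2, w]
  ring

theorem H_12 (x y z t : Pt N) : P.H x y z t = P.H y x z t := by
  simp only [H, P.c4_12 x y]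

theorem H_34 (x y z t : Pt N) : P.H x y z t = P.H x y t z := by
  simp only [H, P.c4_34 _ _ z t]

theorem H_swap (x y z t : Pt N) : P.H x y z t = P.H z t x y := by
  have h : ∀ u v β γ, P.c4 u v β γ = P.c4 β γ u v := fun u v β γ => by
    rw [P.c4_23, P.c4_12, P.c4_34, P.c4_23]
  have h1 : ∀ α, ∑ β, P.c4 x y (P.δ α) (P.δ β) * P.c4 (P.γ α) (P.γ β) z t =
      ∑ β, P.c4 x y (P.δ α) (P.γ β) * P.c4 (P.γ α) (P.δ β) z t := fun α => by
    simpa [h _ _ z t] using P.sum_mul_symm (P.c4 x y (P.δ α)) (P.c4 z t (P.γ α))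
  have h2 : ∀ β, ∑ α, P.c4 x y (P.δ α) (P.γ β) * P.c4 (P.γ α) (P.δ β) z t =
      ∑ α, P.c4 x y (P.γ α) (P.γ β) * P.c4 (P.δ α) (P.δ β) z t := fun β => by
    simpa [h _ _ z t, P.c4_34 _ _ _ (P.γ β), P.c4_34 _ _ _ (P.δ β)] using
      P.sum_mul_symm (P.c4 x y (P.γ β)) (P.c4 z t (P.δ β))
  simp only [H, h1]
  rw [Finset.sum_comm]
  simp only [h2]
  rw [Finset.sum_comm]
  refine Finset.sum_congr rfl fun α _ => Finset.sum_congr rfl fun β _ => ?_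
  rw [h x y, h _ _ z t, mul_comm]

theorem K_comm (x y : Pt N) : P.K x y = P.K y x := by
  simp only [K, P.c4_12 x y]

theorem K_D (x y z t : Pt N) :
    P.K (P.D x y z) t = ∑ α, P.c4 x y z (P.δ α) * P.K (P.γ α) t := by
  simp only [K]
  have h : ∀ β, P.c4 (P.D x y z) t (P.γ β) (P.δ β) =
      ∑ α, P.c4 x y z (P.δ α) * P.c4 (P.γ α) t (P.γ β) (P.δ β) := fun β => by
    simpa [P.c4_12 t] using
      P.map_D x y z (((P.c4 t).compr₂ (LinearMap.applyₗ (P.δ β))).flip (P.γ β))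
  simp only [h, Finset.mul_sum]
  rw [Finset.sum_comm]

theorem sum_K_D : ∑ α, P.K (P.D P.E P.E (P.δ α)) (P.γ α) =
    ∑ α, P.H P.E P.E (P.δ α) (P.γ α) := by
  simp only [H, K_D]
  conv_rhs => rw [Finset.sum_comm]
  refine Finset.sum_congr rfl fun β _ => ?_
  rw [Finset.sum_comm]
  refine Finset.sum_congr rfl fun μ _ => ?_
  rw [← Finset.mul_sum, K_comm, K]
  exact congrArg _ (Finset.sum_congr rfl fun α _ => P.c4_34 _ _ _ _)

theorem sum_K_D' : ∑ α, P.K (P.D P.E P.E (P.γ α)) (P.δ α) =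
    ∑ α, P.H P.E P.E (P.δ α) (P.γ α) := by
  rw [← sum_K_D]
  simp only [K_D]
  rw [Finset.sum_comm]
  conv_rhs => rw [Finset.sum_comm]
  refine Finset.sum_congr rfl fun β _ => ?_
  have h (x : Pt N) : P.K (P.γ β) x = ∑ μ, P.c4 (P.γ β) x (P.γ μ) (P.δ μ) := rfl
  have := P.sum_mul_symm ((P.c4 P.E P.E).flip (P.δ β))
      (∑ μ, ((P.c4 (P.γ β)).flip (P.γ μ)).flip (P.δ μ))
  simp only [LinearMap.flip_apply, LinearMap.sum_apply] at this
  simp only [h]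
  exact this.symm

/-- The genus-zero part of Getzler's equation at a point. -/
noncomputable def genusZero (v : Fin 4 → Pt N) : ℂ :=
  ∑ g : Equiv.Perm (Fin 4),
    ((1 / 6) * P.K (P.D (v (g 0)) (v (g 1)) (v (g 2))) (v (g 3))
    + (1 / 24) * P.c5 (v (g 0)) (v (g 1)) (v (g 2)) (v (g 3)) P.Δ
    - (1 / 4) * P.H (v (g 0)) (v (g 1)) (v (g 2)) (v (g 3)))

theorem genusZero_eq (e x y : Pt N) : P.genusZero ![e, e, x, y] =
    2 * P.K (P.D e x y) e + P.K (P.D e e x) y + P.K (P.D e e y) x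
    + P.c5 e e x y P.Δ - 2 * P.H e e x y - 4 * P.H e x e y := by
  unfold genusZero
  rw [sum_perm_fin_four (fun i j k l =>
    (1 / 6) * P.K (P.D (![e, e, x, y] i) (![e, e, x, y] j) (![e, e, x, y] k)) (![e, e, x, y] l)
    + (1 / 24) * P.c5 (![e, e, x, y] i) (![e, e, x, y] j) (![e, e, x, y] k) (![e, e, x, y] l) P.Δ
    - (1 / 4) * P.H (![e, e, x, y] i) (![e, e, x, y] j) (![e, e, x, y] k) (![e, e, x, y] l))]
  simp only [Matrix.cons_val]
  have c1 : P.c5 e e y x P.Δ = P.c5 e e x y P.Δ := P.c5_34 _ _ _ _ _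
  have c2 : P.c5 e x e y P.Δ = P.c5 e e x y P.Δ := P.c5_23 _ _ _ _ _
  have c3 : P.c5 e y e x P.Δ = P.c5 e e x y P.Δ := by rw [P.c5_23, c1]
  have c4 : P.c5 e x y e P.Δ = P.c5 e e x y P.Δ := by rw [P.c5_34, c2]
  have c5 : P.c5 e y x e P.Δ = P.c5 e e x y P.Δ := by rw [P.c5_34, c3]
  have c6 (a b : Pt N) : P.c5 x e a b P.Δ = P.c5 e x a b P.Δ := P.c5_12 _ _ _ _ _
  have c7 (a b : Pt N) : P.c5 y e a b P.Δ = P.c5 e y a b P.Δ := P.c5_12 _ _ _ _ _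
  have c8 : P.c5 x y e e P.Δ = P.c5 e e x y P.Δ := by rw [P.c5_23, c6, c4]
  have c9 : P.c5 y x e e P.Δ = P.c5 e e x y P.Δ := by rw [P.c5_23, c7, c5]
  have d1 (a : Pt N) : P.D x e a = P.D e x a := P.D_12 _ _ _
  have d2 (a : Pt N) : P.D y e a = P.D e y a := P.D_12 _ _ _
  have d3 : P.D e x e = P.D e e x := P.D_23 _ _ _
  have d4 : P.D e y e = P.D e e y := P.D_23 _ _ _
  have d5 : P.D e y x = P.D e x y := P.D_23 _ _ _
  have d6 : P.D x y e = P.D e x y := by rw [P.D_23, P.D_12]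
  have d7 : P.D y x e = P.D e x y := by rw [P.D_12, d6]
  have h1 (a b : Pt N) : P.H x e a b = P.H e x a b := P.H_12 _ _ _ _
  have h2 (a b : Pt N) : P.H y e a b = P.H e y a b := P.H_12 _ _ _ _
  have h3 (a b : Pt N) : P.H a b x e = P.H a b e x := P.H_34 _ _ _ _
  have h4 (a b : Pt N) : P.H a b y e = P.H a b e y := P.H_34 _ _ _ _
  have h5 : P.H e y e x = P.H e x e y := P.H_swap _ _ _ _
  have h6 : P.H y x e e = P.H e e x y := by rw [P.H_12, P.H_swap]
  have h7 : P.H x y e e = P.H e e x y := P.H_swap _ _ _ _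
  have h8 : P.H e e y x = P.H e e x y := P.H_34 _ _ _ _
  simp only [c1, c2, c3, c4, c5, c6, c7, c8, c9, d1, d2, d3, d4, d5, d6, d7,
    h1, h2, h3, h4, h5, h6, h7, h8]
  ring

/-- Linearity of `K` in its first argument. -/
theorem K_left (x y : Pt N) (a : ℂ) (t : Pt N) : P.K (a • x - y) t = a * P.K x t - P.K y t := by
  simp [K, Finset.sum_sub_distrib, Finset.mul_sum]

theorem map_Δ (g : Pt N →ₗ[ℂ] ℂ) :
    g P.Δ = ∑ σ, (∑ α, P.c3 (P.δ α) (P.γ α)) (P.δ σ) * g (P.γ σ) := by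
  rw [Δ, map_sum]
  simp only [P.map_m _ _ g, LinearMap.sum_apply, Finset.sum_mul, smul_eq_mul]
  rw [Finset.sum_comm]

theorem K_Δ_E : P.K P.Δ P.E = (1 / 2 - P.b1) * P.V := by
  have h : ∀ α, P.c4 P.Δ P.E (P.γ α) (P.δ α) = P.c3 (P.G (P.δ α)) (P.γ α) P.Δ
      + P.b α * P.c3 (P.δ α) (P.γ α) P.Δ + P.c3 (P.δ α) (P.γ α) (P.G P.Δ)
      - (P.b1 + 1) * P.c3 (P.δ α) (P.γ α) P.Δ := fun α => by
    have h1 : P.c4 P.E (P.δ α) (P.γ α) P.Δ = _ := P.c4_E _ _ _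
    change _ = P.c3 (P.G (P.δ α)) _ _ + P.c3 _ (P.G (P.γ α)) _ + P.c3 _ _ (P.G P.Δ) - _ at h1
    rw [P.c4_12, P.c4_23, P.c4_34, P.c4_23, h1, G_γ]
    simp
  simp only [K, h, Finset.sum_add_distrib, Finset.sum_sub_distrib, ← Finset.mul_sum, sum_c3_G,
    sum_b_c3]
  have hG : ∑ α, P.c3 (P.δ α) (P.γ α) (P.G P.Δ) = 1 / 2 * P.V := by
    have hθ (z : Pt N) : ∑ α, P.c3 (P.δ α) (P.γ α) z = (∑ α, P.c3 (P.δ α) (P.γ α)) z := by simp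
    have hz := P.map_Δ
    set θ := ∑ α, P.c3 (P.δ α) (P.γ α) with hdef
    rw [V]
    simp only [hθ]
    have h1 := hz (θ.comp P.G)
    have h2 := hz θ
    have h3 := P.sum_G ((LinearMap.mul ℂ ℂ).compl₁₂ θ θ) fun x y => by
      simp [mul_comm]
    have h4 := P.sum_mul_symm θ (θ.comp P.G)
    simp only [LinearMap.comp_apply, LinearMap.compl₁₂_apply, LinearMap.mul_apply', smul_eq_mul]
      at h1 h2 h3 h4
    rw [h1, h2, h4, ← h3]
    exact Finset.sum_congr rfl fun α _ => mul_comm _ _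
  rw [hG, ← V]
  ring

theorem sum_genusZero : ∑ α, P.genusZero ![P.E, P.E, P.δ α, P.γ α] =
    ∑ α, (P.c5 P.E P.E (P.γ α) (P.δ α) P.Δ
      + 2 * P.c4 ((P.b1 + 1) • P.Δ - P.G P.Δ) P.E (P.γ α) (P.δ α))
    - 12 * ∑ α, (P.b α * (1 - P.b α) - (P.b1 + 1) / 6) * P.c3 (P.γ α) (P.δ α) P.Δ := by
  have hK : ∑ α, P.K (P.D P.E (P.δ α) (P.γ α)) P.E =
      (1 - P.b1) * P.K P.Δ P.E - P.K (P.G P.Δ) P.E := by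
    rw [← K_left, ← sum_D_E]
    simp only [K, map_sum, LinearMap.sum_apply]
    rw [Finset.sum_comm]
  have hK' : ∑ α, P.c4 ((P.b1 + 1) • P.Δ - P.G P.Δ) P.E (P.γ α) (P.δ α) =
      (P.b1 + 1) * P.K P.Δ P.E - P.K (P.G P.Δ) P.E := P.K_left _ _ _ _
  have h3 : ∀ α, (P.b α * (1 - P.b α) - (P.b1 + 1) / 6) * P.c3 (P.γ α) (P.δ α) P.Δ =
      P.b α * P.c3 (P.δ α) (P.γ α) P.Δ - P.b α ^ 2 * P.c3 (P.δ α) (P.γ α) P.Δ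
      - (P.b1 + 1) / 6 * P.c3 (P.δ α) (P.γ α) P.Δ := fun α => by
    rw [P.c3_12]; ring
  simp only [genusZero_eq, h3, Finset.sum_add_distrib, Finset.sum_sub_distrib, ← Finset.mul_sum,
    hK, hK', sum_K_D, sum_K_D', sum_H, sum_b_c3, K_Δ_E, P.c5_34 _ _ (P.δ _) (P.γ _)]
  rw [← V, ← V2]
  ring

end GWPoint

end Pointwise

section Tensors
variable {N : ℕ}

/-- The tensor of first derivatives of `F` at `t`. -/
noncomputable def tens1 (F : Pt N → ℂ) (t : Pt N) : Pt N →ₗ[ℂ] ℂ :=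
  Fintype.linearCombination ℂ fun α => pd α F t

/-- The tensor of second derivatives of `F` at `t`. -/
noncomputable def tens2 (F : Pt N → ℂ) (t : Pt N) : Pt N →ₗ[ℂ] Pt N →ₗ[ℂ] ℂ :=
  Fintype.linearCombination ℂ fun α => tens1 (pd α F) t

/-- The tensor of third derivatives of `F` at `t`. -/
noncomputable def tens3 (F : Pt N → ℂ) (t : Pt N) : Pt N →ₗ[ℂ] Pt N →ₗ[ℂ] Pt N →ₗ[ℂ] ℂ :=
  Fintype.linearCombination ℂ fun α => tens2 (pd α F) t

/-- The tensor of fourth derivatives of `F` at `t`. -/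
noncomputable def tens4 (F : Pt N → ℂ) (t : Pt N) :
    Pt N →ₗ[ℂ] Pt N →ₗ[ℂ] Pt N →ₗ[ℂ] Pt N →ₗ[ℂ] ℂ :=
  Fintype.linearCombination ℂ fun α => tens3 (pd α F) t

/-- The tensor of fifth derivatives of `F` at `t`. -/
noncomputable def tens5 (F : Pt N → ℂ) (t : Pt N) :
    Pt N →ₗ[ℂ] Pt N →ₗ[ℂ] Pt N →ₗ[ℂ] Pt N →ₗ[ℂ] Pt N →ₗ[ℂ] ℂ :=
  Fintype.linearCombination ℂ fun α => tens4 (pd α F) t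

theorem tens1_apply (F : Pt N → ℂ) (t u : Pt N) : tens1 F t u = ∑ α, u α * pd α F t := by
  simp [tens1, Fintype.linearCombination_apply]

theorem tens2_apply (F : Pt N → ℂ) (t u : Pt N) :
    tens2 F t u = ∑ α, u α • tens1 (pd α F) t := by
  simp [tens2, Fintype.linearCombination_apply]

theorem tens3_apply (F : Pt N → ℂ) (t u : Pt N) :
    tens3 F t u = ∑ α, u α • tens2 (pd α F) t := by
  simp [tens3, Fintype.linearCombination_apply]

theorem tens4_apply (F : Pt N → ℂ) (t u : Pt N) :
    tens4 F t u = ∑ α, u α • tens3 (pd α F) t := by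
  simp [tens4, Fintype.linearCombination_apply]

theorem tens5_apply (F : Pt N → ℂ) (t u : Pt N) :
    tens5 F t u = ∑ α, u α • tens4 (pd α F) t := by
  simp [tens5, Fintype.linearCombination_apply]

theorem corr_one (F : Pt N → ℂ) (u : VF N) (t : Pt N) : corr F [u] t = tens1 F t (u t) := by
  simp [tens1_apply, corr]

theorem corr_two (F : Pt N → ℂ) (u v : VF N) (t : Pt N) :
    corr F [u, v] t = tens2 F t (u t) (v t) := by
  rw [corr]; simp only [corr_one, tens2_apply]; simp

theorem corr_three (F : Pt N → ℂ) (u v w : VF N) (t : Pt N) :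
    corr F [u, v, w] t = tens3 F t (u t) (v t) (w t) := by
  rw [corr]; simp only [corr_two, tens3_apply]; simp

theorem corr_four (F : Pt N → ℂ) (u v w x : VF N) (t : Pt N) :
    corr F [u, v, w, x] t = tens4 F t (u t) (v t) (w t) (x t) := by
  rw [corr]; simp only [corr_three, tens4_apply]; simp

theorem corr_five (F : Pt N → ℂ) (u v w x y : VF N) (t : Pt N) :
    corr F [u, v, w, x, y] t = tens5 F t (u t) (v t) (w t) (x t) (y t) := by
  rw [corr]; simp only [corr_four, tens5_apply]; simp

variable {F : Pt N → ℂ}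

theorem corr_cons (F : Pt N → ℂ) (v : VF N) (vs : List (VF N)) :
    corr F (v :: vs) = fun t => ∑ α, v t α * corr (pd α F) vs t := rfl

theorem analyticAt_pd (hF : ∀ t, AnalyticAt ℂ F t) (α : Fin N) :
    ∀ t, AnalyticAt ℂ (pd α F) t := fun t =>
  ((ContinuousLinearMap.apply ℂ ℂ (Pi.single α 1 : Pt N)).analyticAt _).comp (hF t).fderiv

theorem pd_comm (hF : ∀ t, AnalyticAt ℂ F t) (α β : Fin N) :
    pd α (pd β F) = pd β (pd α F) := by
  have h : ∀ α β t, pd α (pd β F) t =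
      fderiv ℂ (fderiv ℂ F) t (Pi.single α 1) (Pi.single β 1) := by
    intro α β t
    have hd : DifferentiableAt ℂ (fderiv ℂ F) t := (hF t).fderiv.differentiableAt
    unfold pd
    rw [fderiv_clm_apply hd (differentiableAt_const _)]
    simp
  funext t
  rw [h, h]
  exact ((hF t).contDiffAt (n := 2)).isSymmSndFDerivAt (by simp) _ _

theorem tens2_12 (hF : ∀ t, AnalyticAt ℂ F t) (t u v : Pt N) :
    tens2 F t u v = tens2 F t v u := by
  simp only [tens2_apply, LinearMap.sum_apply, LinearMap.smul_apply, tens1_apply, smul_eq_mul,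
    Finset.mul_sum]
  rw [Finset.sum_comm]
  refine Finset.sum_congr rfl fun α _ => Finset.sum_congr rfl fun β _ => ?_
  rw [mul_left_comm, pd_comm hF]

theorem tens3_12 (hF : ∀ t, AnalyticAt ℂ F t) (t u v : Pt N) :
    tens3 F t u v = tens3 F t v u := by
  simp only [tens3_apply, LinearMap.sum_apply, LinearMap.smul_apply, tens2_apply, Finset.smul_sum]
  rw [Finset.sum_comm]
  refine Finset.sum_congr rfl fun α _ => Finset.sum_congr rfl fun β _ => ?_
  rw [smul_comm, pd_comm hF]

theorem tens4_12 (hF : ∀ t, AnalyticAt ℂ F t) (t u v : Pt N) :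
    tens4 F t u v = tens4 F t v u := by
  simp only [tens4_apply, LinearMap.sum_apply, LinearMap.smul_apply, tens3_apply, Finset.smul_sum]
  rw [Finset.sum_comm]
  refine Finset.sum_congr rfl fun α _ => Finset.sum_congr rfl fun β _ => ?_
  rw [smul_comm, pd_comm hF]

theorem tens5_12 (hF : ∀ t, AnalyticAt ℂ F t) (t u v : Pt N) :
    tens5 F t u v = tens5 F t v u := by
  simp only [tens5_apply, LinearMap.sum_apply, LinearMap.smul_apply, tens4_apply, Finset.smul_sum]
  rw [Finset.sum_comm]
  refine Finset.sum_congr rfl fun α _ => Finset.sum_congr rfl fun β _ => ?_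
  rw [smul_comm, pd_comm hF]

theorem tens3_23 (hF : ∀ t, AnalyticAt ℂ F t) (t u v w : Pt N) :
    tens3 F t u v w = tens3 F t u w v := by
  simp only [tens3_apply, LinearMap.sum_apply, LinearMap.smul_apply,
    tens2_12 (analyticAt_pd hF _) t v]

theorem tens4_23 (hF : ∀ t, AnalyticAt ℂ F t) (t u v w : Pt N) :
    tens4 F t u v w = tens4 F t u w v := by
  simp only [tens4_apply, LinearMap.sum_apply, LinearMap.smul_apply,
    tens3_12 (analyticAt_pd hF _) t v]

theorem tens4_34 (hF : ∀ t, AnalyticAt ℂ F t) (t u v w x : Pt N) :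
    tens4 F t u v w x = tens4 F t u v x w := by
  simp only [tens4_apply, LinearMap.sum_apply, LinearMap.smul_apply,
    tens3_23 (analyticAt_pd hF _) t v w]

theorem tens5_23 (hF : ∀ t, AnalyticAt ℂ F t) (t u v w : Pt N) :
    tens5 F t u v w = tens5 F t u w v := by
  simp only [tens5_apply, LinearMap.sum_apply, LinearMap.smul_apply,
    tens4_12 (analyticAt_pd hF _) t v]

theorem tens5_34 (hF : ∀ t, AnalyticAt ℂ F t) (t u v w x : Pt N) :
    tens5 F t u v w x = tens5 F t u v x w := by
  simp only [tens5_apply, LinearMap.sum_apply, LinearMap.smul_apply,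
    tens4_23 (analyticAt_pd hF _) t v w]

theorem fderiv_eq_tens1 (t x : Pt N) :
    fderiv ℂ F t x = tens1 F t x := by
  rw [tens1_apply]
  conv_lhs => rw [pi_eq_sum_univ' x, map_sum]
  simp [pd]

theorem differentiable_corr {vs : List (VF N)} (hF : ∀ t, AnalyticAt ℂ F t)
    (hv : ∀ v ∈ vs, Differentiable ℂ v) : Differentiable ℂ (corr F vs) := by
  induction vs generalizing F with
  | nil => exact fun t => (hF t).differentiableAt
  | cons v vs ih =>
    rw [corr_cons]
    have h1 : ∀ α, Differentiable ℂ (fun t => v t α) :=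
      differentiable_pi.1 (hv v (by simp))
    have h2 : ∀ α, Differentiable ℂ (corr (pd α F) vs) := fun α =>
      ih (analyticAt_pd hF α) fun w hw => hv w (by simp [hw])
    exact Differentiable.fun_sum fun α _ => (h1 α).mul (h2 α)

theorem fderiv_corr_cons {v : VF N} {vs : List (VF N)} (hF : ∀ t, AnalyticAt ℂ F t)
    (hv : Differentiable ℂ v) (hvs : ∀ v ∈ vs, Differentiable ℂ v) (t x : Pt N) :
    fderiv ℂ (corr F (v :: vs)) t x =
      corr F (cvf (fderiv ℂ v t x) :: vs) t +
        ∑ α, v t α * fderiv ℂ (corr (pd α F) vs) t x := by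
  have h1 : ∀ α, DifferentiableAt ℂ (fun t => v t α) t := fun α =>
    differentiableAt_pi.1 (hv t) α
  have h2 : ∀ α, DifferentiableAt ℂ (corr (pd α F) vs) t := fun α =>
    differentiable_corr (analyticAt_pd hF α) hvs t
  have h3 : ∀ α, fderiv ℂ (fun s => v s α) t x = fderiv ℂ v t x α := fun α => by
    rw [fderiv_apply (hv t)]; rfl
  simp only [corr_cons]
  rw [fderiv_fun_sum fun α _ => (h1 α).fun_mul (h2 α)]
  simp only [fderiv_fun_mul (h1 _) (h2 _), sum_apply,
    add_apply, smul_apply, smul_eq_mul, h3, cvf]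
  rw [← Finset.sum_add_distrib]
  refine Finset.sum_congr rfl fun α _ => ?_
  ring

variable {u v w y : VF N}

theorem fderiv_corr_one (hF : ∀ t, AnalyticAt ℂ F t) (hu : Differentiable ℂ u) (t x : Pt N) :
    fderiv ℂ (corr F [u]) t x = tens1 F t (fderiv ℂ u t x) + tens2 F t (u t) x := by
  rw [fderiv_corr_cons hF hu (by simp), corr_one]
  simp only [corr, fderiv_eq_tens1, tens2_apply]
  simp [cvf]

theorem fderiv_corr_two (hF : ∀ t, AnalyticAt ℂ F t) (hu : Differentiable ℂ u)
    (hv : Differentiable ℂ v) (t x : Pt N) :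
    fderiv ℂ (corr F [u, v]) t x = tens2 F t (fderiv ℂ u t x) (v t) +
      tens2 F t (u t) (fderiv ℂ v t x) + tens3 F t (u t) (v t) x := by
  rw [fderiv_corr_cons hF hu (by simpa), corr_two]
  simp only [fderiv_corr_one (analyticAt_pd hF _) hv, tens2_apply _ _ (u t), tens3_apply]
  simp [cvf, mul_add, Finset.sum_add_distrib, add_assoc]

theorem fderiv_corr_three (hF : ∀ t, AnalyticAt ℂ F t) (hu : Differentiable ℂ u)
    (hv : Differentiable ℂ v) (hw : Differentiable ℂ w) (t x : Pt N) :
    fderiv ℂ (corr F [u, v, w]) t x = tens3 F t (fderiv ℂ u t x) (v t) (w t) +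
      tens3 F t (u t) (fderiv ℂ v t x) (w t) + tens3 F t (u t) (v t) (fderiv ℂ w t x) +
      tens4 F t (u t) (v t) (w t) x := by
  rw [fderiv_corr_cons hF hu (by simp [hv, hw]), corr_three]
  simp only [fderiv_corr_two (analyticAt_pd hF _) hv hw, tens3_apply _ _ (u t), tens4_apply]
  simp [cvf, mul_add, Finset.sum_add_distrib, add_assoc]

theorem fderiv_corr_four (hF : ∀ t, AnalyticAt ℂ F t) (hu : Differentiable ℂ u)
    (hv : Differentiable ℂ v) (hw : Differentiable ℂ w) (hy : Differentiable ℂ y) (t x : Pt N) :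
    fderiv ℂ (corr F [u, v, w, y]) t x = tens4 F t (fderiv ℂ u t x) (v t) (w t) (y t) +
      tens4 F t (u t) (fderiv ℂ v t x) (w t) (y t) +
      tens4 F t (u t) (v t) (fderiv ℂ w t x) (y t) +
      tens4 F t (u t) (v t) (w t) (fderiv ℂ y t x) +
      tens5 F t (u t) (v t) (w t) (y t) x := by
  rw [fderiv_corr_cons hF hu (by simp [hv, hw, hy]), corr_four]
  simp only [fderiv_corr_three (analyticAt_pd hF _) hv hw hy, tens4_apply _ _ (u t), tens5_apply]
  simp [cvf, mul_add, Finset.sum_add_distrib, add_assoc]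

theorem differentiable_cvf (x : Pt N) : Differentiable ℂ (cvf x : VF N) :=
  differentiable_const x

theorem fderiv_cvf (z t x : Pt N) : fderiv ℂ (cvf z : VF N) t x = 0 := by
  have : (cvf z : VF N) = fun _ => z := rfl
  simp [this]

theorem differentiable_euler (c : Pt N) (b : Fin N → ℂ) (b1 : ℂ) :
    Differentiable ℂ (euler c b b1) := by
  unfold euler; fun_prop

theorem fderiv_euler (c : Pt N) (b : Fin N → ℂ) (b1 : ℂ) (t x : Pt N) :
    fderiv ℂ (euler c b b1) t x = fun α => (b1 + 1 - b α) * x α := by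
  ext α
  have h : fderiv ℂ (euler c b b1) t x α = fderiv ℂ (fun s => euler c b b1 s α) t x := by
    rw [fderiv_apply (differentiable_euler c b b1 t)]; rfl
  have h' : DifferentiableAt ℂ (fun s : Pt N => s α) t := by fun_prop
  rw [h]
  simp only [euler]
  rw [fderiv_const_add, fderiv_const_mul h', fderiv_apply differentiableAt_id]
  simp

theorem differentiable_qp (hF : ∀ t, AnalyticAt ℂ F t) (ηinv : Matrix (Fin N) (Fin N) ℂ)
    (hu : Differentiable ℂ u) (hv : Differentiable ℂ v) :
    Differentiable ℂ (qp F ηinv u v) := by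
  refine differentiable_pi.2 fun σ => ?_
  exact differentiable_corr hF (by simp [hu, hv, dua, differentiable_cvf])

theorem fderiv_qp (hF : ∀ t, AnalyticAt ℂ F t) (ηinv : Matrix (Fin N) (Fin N) ℂ)
    (hu : Differentiable ℂ u) (hv : Differentiable ℂ v) (t x : Pt N) :
    fderiv ℂ (qp F ηinv u v) t x = raise ηinv (tens3 F t (fderiv ℂ u t x) (v t)) +
      raise ηinv (tens3 F t (u t) (fderiv ℂ v t x)) + raise ηinv (tens4 F t x (u t) (v t)) := by
  ext σ
  have h : fderiv ℂ (qp F ηinv u v) t x σ = fderiv ℂ (fun s => qp F ηinv u v s σ) t x := by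
    rw [fderiv_apply (differentiable_qp hF ηinv hu hv t)]; rfl
  have h' : tens4 F t (u t) (v t) (ηinv σ) x = tens4 F t x (u t) (v t) (ηinv σ) := by
    rw [tens4_34 hF, tens4_23 hF, tens4_12 hF]
  rw [h]
  unfold qp
  have := fderiv_corr_three hF hu hv (differentiable_cvf (ηinv σ)) t x
  rw [fderiv_cvf, map_zero, add_zero] at this
  exact this.trans (congrArg _ h')

theorem qp_apply (F : Pt N → ℂ) (ηinv : Matrix (Fin N) (Fin N) ℂ) (u v : VF N) (t : Pt N) :
    qp F ηinv u v t = raise ηinv (tens3 F t (u t) (v t)) := by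
  ext σ
  exact corr_three _ _ _ _ _

end Tensors

section QuasiHomogeneity
variable {N : ℕ} {F : Pt N → ℂ} {b : Fin N → ℂ} {b1 : ℂ} {c : Pt N}

theorem tens2_euler (hF : ∀ t, AnalyticAt ℂ F t) {k : ℂ}
    (h : ∀ t, fderiv ℂ F t (euler c b b1 t) = k) (t x : Pt N) :
    tens2 F t (euler c b b1 t) x = tens1 F t (fun α => b α * x α) - (b1 + 1) * tens1 F t x := by
  have h1 : corr F [euler c b b1] = fun _ => k := by
    funext t; rw [corr_one, ← fderiv_eq_tens1, h]
  have h2 := congrArg (fun f => fderiv ℂ f t x) h1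
  simp only [fderiv_corr_one hF (differentiable_euler c b b1), fderiv_euler] at h2
  have h3 : (fun α => (b1 + 1 - b α) * x α) = (b1 + 1) • x - fun α => b α * x α := by
    ext α; simp [sub_mul]
  rw [h3, map_sub, map_smul, smul_eq_mul] at h2
  simp only [fderiv_fun_const, Pi.zero_apply, zero_apply] at h2
  linear_combination h2

theorem fderiv_quadratic (C : Matrix (Fin N) (Fin N) ℂ) (t x : Pt N) :
    fderiv ℂ (fun t : Pt N => ∑ α, ∑ β, C α β * t α * t β) t x =
      ∑ α, ∑ β, C α β * (x α * t β + t α * x β) := by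
  have h1 : ∀ α, HasFDerivAt (fun t : Pt N => t α)
      (ContinuousLinearMap.proj (R := ℂ) (φ := fun _ : Fin N => ℂ) α) t := fun α =>
    hasFDerivAt_apply α t
  have h2 := HasFDerivAt.fun_sum (u := Finset.univ) fun α _ =>
    HasFDerivAt.fun_sum (u := Finset.univ) fun β _ => ((h1 α).const_mul (C α β)).fun_mul (h1 β)
  rw [h2.fderiv]
  simp only [sum_apply, add_apply, smul_apply, ContinuousLinearMap.proj_apply, smul_eq_mul]
  exact Finset.sum_congr rfl fun α _ => Finset.sum_congr rfl fun β _ => by ring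

theorem fderiv_linear (C : Matrix (Fin N) (Fin N) ℂ) (t x y : Pt N) :
    fderiv ℂ (fun t : Pt N => ∑ α, ∑ β, C α β * (x α * t β + t α * x β)) t y =
      ∑ α, ∑ β, C α β * (x α * y β + y α * x β) := by
  have h1 : ∀ α, HasFDerivAt (fun t : Pt N => t α)
      (ContinuousLinearMap.proj (R := ℂ) (φ := fun _ : Fin N => ℂ) α) t := fun α =>
    hasFDerivAt_apply α t
  have h2 := HasFDerivAt.fun_sum (u := Finset.univ) fun α _ =>
    HasFDerivAt.fun_sum (u := Finset.univ) fun β _ =>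
      (((h1 β).const_mul (x α)).fun_add ((h1 α).mul_const (x β))).const_mul (C α β)
  rw [h2.fderiv]
  simp only [sum_apply, add_apply, smul_apply, ContinuousLinearMap.proj_apply, smul_eq_mul]
  exact Finset.sum_congr rfl fun α _ => Finset.sum_congr rfl fun β _ => by ring

theorem tens4_euler (hF : ∀ t, AnalyticAt ℂ F t) {C : Matrix (Fin N) (Fin N) ℂ}
    (h : ∀ t, fderiv ℂ F t (euler c b b1 t) =
      2 * (b1 + 1) * F t + (1 / 2) * ∑ α, ∑ β, C α β * t α * t β) (t x y z : Pt N) :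
    tens4 F t (euler c b b1 t) x y z = tens3 F t (fun α => b α * x α) y z +
      tens3 F t x (fun α => b α * y α) z + tens3 F t x y (fun α => b α * z α) -
      (b1 + 1) * tens3 F t x y z := by
  have hE := differentiable_euler c b b1
  have hc := @differentiable_cvf N
  set A : Pt N → Pt N := fun x α => (b1 + 1 - b α) * x α with hA
  have hA' : ∀ x, A x = (b1 + 1) • x - fun α => b α * x α := fun x => by
    ext α; simp [hA, sub_mul]
  have hE' : ∀ t x, fderiv ℂ (euler c b b1) t x = A x := fderiv_euler c b b1
  have h1 : corr F [euler c b b1] =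
      fun t => 2 * (b1 + 1) * F t + (1 / 2) * ∑ α, ∑ β, C α β * t α * t β := by
    funext t; rw [corr_one, ← fderiv_eq_tens1, h]
  have hd : Differentiable ℂ F := fun t => (hF t).differentiableAt
  have hQ : Differentiable ℂ fun t : Pt N => ∑ α, ∑ β, C α β * t α * t β := by fun_prop
  have hL : ∀ x : Pt N, Differentiable ℂ
      fun t : Pt N => ∑ α, ∑ β, C α β * (x α * t β + t α * x β) := fun x => by fun_prop
  have h2 (x : Pt N) : corr F [euler c b b1, cvf x] = fun t =>
      2 * (b1 + 1) * corr F [cvf x] t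
        + (1 / 2) * ∑ α, ∑ β, C α β * (x α * t β + t α * x β) - corr F [cvf (A x)] t := by
    funext t
    have h2 := congrArg (fun f => fderiv ℂ f t x) h1
    simp only [fderiv_corr_one hF hE, hE'] at h2
    rw [fderiv_fun_add ((hd t).const_mul _) ((hQ t).const_mul _), fderiv_const_mul (hd t),
      fderiv_const_mul (hQ t), add_apply, smul_apply, smul_apply, fderiv_quadratic,
      fderiv_eq_tens1] at h2
    rw [corr_two, corr_one, corr_one]
    simp only [smul_eq_mul] at h2
    exact (eq_sub_of_add_eq' h2)
  have d1 (x : Pt N) : Differentiable ℂ (corr F [cvf x]) := differentiable_corr hF (by simp [hc])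
  have d2 (x y : Pt N) : Differentiable ℂ (corr F [cvf x, cvf y]) :=
    differentiable_corr hF (by simp [hc])
  have h3 (x y : Pt N) : corr F [euler c b b1, cvf x, cvf y] = fun t =>
      2 * (b1 + 1) * corr F [cvf x, cvf y] t
        + (1 / 2) * (∑ α, ∑ β, C α β * (x α * y β + y α * x β)) - corr F [cvf (A x), cvf y] t
        - corr F [cvf (A y), cvf x] t := by
    funext t
    have h3 := congrArg (fun f => fderiv ℂ f t y) (h2 x)
    simp only [fderiv_corr_two hF hE (hc x), hE', fderiv_cvf, map_zero] at h3
    rw [fderiv_fun_sub (((d1 x t).const_mul _).fun_add ((hL x t).const_mul _)) (d1 _ t),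
      fderiv_fun_add ((d1 x t).const_mul _) ((hL x t).const_mul _), fderiv_const_mul (d1 x t),
      fderiv_const_mul (hL x t), sub_apply, add_apply, smul_apply, smul_apply, fderiv_linear,
      fderiv_corr_one hF (hc _), fderiv_corr_one hF (hc _), fderiv_cvf, fderiv_cvf] at h3
    simp only [corr_three, corr_two]
    simp only [smul_eq_mul, map_zero, zero_add] at h3
    simp only [cvf] at h3 ⊢
    linear_combination h3
  have h4 := congrArg (fun f => fderiv ℂ f t z) (h3 x y)
  simp only [fderiv_corr_three hF hE (hc x) (hc y), hE', fderiv_cvf, map_zero] at h4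
  rw [fderiv_fun_sub ((((d2 x y t).const_mul _).add_const _).fun_sub (d2 _ _ t)) (d2 _ _ t),
    fderiv_fun_sub (((d2 x y t).const_mul _).add_const _) (d2 _ _ t), fderiv_add_const,
    fderiv_const_mul (d2 x y t), sub_apply, sub_apply, smul_apply,
    fderiv_corr_two hF (hc _) (hc _), fderiv_corr_two hF (hc _) (hc _),
    fderiv_corr_two hF (hc _) (hc _)] at h4
  simp only [fderiv_cvf, map_zero, zero_add, smul_eq_mul, cvf, hA', map_sub,
    map_smul, LinearMap.sub_apply, LinearMap.smul_apply, LinearMap.zero_apply, add_zero] at h4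
  rw [tens3_12 hF t z x, tens3_12 hF t (fun α => b α * z α) x, tens3_12 hF t y x,
    tens3_12 hF t (fun α => b α * y α) x, tens3_23 hF t x z y,
    tens3_23 hF t x (fun α => b α * z α) y] at h4
  linear_combination h4

end QuasiHomogeneity

section Reduction
variable {N : ℕ}

/-- The data of Getzler's equation at the point `t`. -/
noncomputable def gwPoint {ηm ηinv : Matrix (Fin N) (Fin N) ℂ} (hηsym : ηm.IsSymm)
    (hη : ηm * ηinv = 1) {b : Fin N → ℂ} {b1 : ℂ} (hb : ∀ α β, ηinv α β ≠ 0 → b α + b β = 1)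
    {c : Pt N} {C : Matrix (Fin N) (Fin N) ℂ} {F0 F1 : Pt N → ℂ}
    (hF0 : ∀ t, AnalyticAt ℂ F0 t) (hF1 : ∀ t, AnalyticAt ℂ F1 t)
    (hwdvv : ∀ u v w : VF N,
      qp F0 ηinv (qp F0 ηinv u v) w = qp F0 ηinv u (qp F0 ηinv v w))
    (hqh0 : ∀ t, fderiv ℂ F0 t (euler c b b1 t)
      = 2 * (b1 + 1) * F0 t + (1 / 2) * ∑ α, ∑ β, C α β * t α * t β)
    (hqh1 : ∃ k : ℂ, ∀ t, fderiv ℂ F1 t (euler c b b1 t) = k) (t : Pt N) : GWPoint N where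
  ηm := ηm
  ηinv := ηinv
  η_symm := by
    rw [← Matrix.inv_eq_right_inv hη]
    exact hηsym.inv
  η_mul := hη
  b := b
  b1 := b1
  b_add := hb
  c3 := tens3 F0 t
  c4 := tens4 F0 t
  c5 := tens5 F0 t
  f1 := tens1 F1 t
  f2 := tens2 F1 t
  E := euler c b b1 t
  c3_12 u v w := by rw [tens3_12 hF0]
  c3_23 := tens3_23 hF0 t
  c4_12 u v w x := by rw [tens4_12 hF0]
  c4_23 u v w x := by rw [tens4_23 hF0]
  c4_34 := tens4_34 hF0 t
  c5_12 u v w x y := by rw [tens5_12 hF0]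
  c5_23 u v w x y := by rw [tens5_23 hF0]
  c5_34 u v w x y := by rw [tens5_34 hF0]
  f2_12 := tens2_12 hF1 t
  assoc u v w := by
    have h := congrFun (hwdvv (cvf u) (cvf v) (cvf w)) t
    simp only [qp_apply] at h
    exact h
  assoc_deriv x u v w := by
    have hc := @differentiable_cvf N
    have h := congrArg (fun f => fderiv ℂ f t x) (hwdvv (cvf u) (cvf v) (cvf w))
    simp only [fderiv_qp hF0 ηinv (differentiable_qp hF0 ηinv (hc u) (hc v)) (hc w),
      fderiv_qp hF0 ηinv (hc u) (differentiable_qp hF0 ηinv (hc v) (hc w)),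
      fderiv_qp hF0 ηinv (hc _) (hc _), fderiv_cvf, map_zero, LinearMap.zero_apply, add_zero,
      zero_add, qp_apply] at h
    exact (add_comm _ _).trans (h.trans (add_comm _ _))
  c4_E := tens4_euler hF0 hqh0 t
  f2_E := tens2_euler hF1 hqh1.choose_spec t

theorem GWPoint.map_Δ_dual (P : GWPoint N) (g : Pt N →ₗ[ℂ] ℂ) :
    g P.Δ = ∑ α, g (P.δ α) * ∑ β, P.c3 (P.γ α) (P.γ β) (P.δ β) := by
  rw [P.map_Δ, P.sum_mul_symm]
  refine Finset.sum_congr rfl fun α _ => ?_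
  rw [mul_comm, LinearMap.sum_apply]
  congr 1
  refine Finset.sum_congr rfl fun β _ => ?_
  rw [P.c3_12, P.c3_23, P.c3_12, P.c3_23]

variable (P : GWPoint N) {F0 F1 : Pt N → ℂ} {t : Pt N}

theorem qvol_eq (h3 : P.c3 = tens3 F0 t) : qvol F0 P.ηinv t = P.Δ := by
  simp only [qvol, qp_apply, ← h3]
  rfl

theorem G0func_eq (h3 : P.c3 = tens3 F0 t) (h4 : P.c4 = tens4 F0 t) (h5 : P.c5 = tens5 F0 t)
    (v : Fin 4 → VF N) : G0func F0 P.ηinv v t = P.genusZero fun i => v i t := by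
  refine Finset.sum_congr rfl fun g _ => ?_
  simp only [corr_three, corr_four, corr_five, ← h3, ← h4, ← h5, P.map_Δ_dual, P.K_D]
  rfl

theorem G1func_eq (h3 : P.c3 = tens3 F0 t) (h4 : P.c4 = tens4 F0 t) (f1 : P.f1 = tens1 F1 t)
    (f2 : P.f2 = tens2 F1 t) (v : Fin 4 → VF N) :
    G1func F0 F1 P.ηinv v t = P.genusOne fun i => v i t := by
  refine Finset.sum_congr rfl fun g _ => ?_
  have h (x y z w : Pt N) : P.f1 (P.m (P.D x y z) w) =
      ∑ α, P.c4 x y z (P.δ α) * P.f1 (P.m (P.γ α) w) :=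
    P.map_D x y z (P.f1.comp (P.m.flip w))
  simp only [corr_one, corr_two, corr_four, qp_apply, ← h3, ← h4, ← f1, ← f2, h, P.map_D _ _ _ P.f1]
  rfl

end Reduction

/-- Derivative of the genus-1 Virasoro conjecture along the quantum volume element:
under WDVV, quasi-homogeneity, the identity axiom and Getzler's equation `G₀ + G₁ = 0`,
the vector field `Δ = γ^α ∘ γ_α` annihilates
`Ψ = ⟨⟨E²⟩⟩₁ + (1/24)Σ_α ⟨⟨E E γ_α γ^α⟩⟩₀ − (1/2)Σ_α (b_α(1−b_α) − (b₁+1)/6)⟨⟨γ_α γ^α⟩⟩₀`. -/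
theorem qvol_annihilates_Psi
    {N : ℕ} [NeZero N]
    (ηm ηinv : Matrix (Fin N) (Fin N) ℂ)
    (hηsym : ηm.IsSymm)
    (hη1 : ηm * ηinv = 1) (hη2 : ηinv * ηm = 1)
    (b : Fin N → ℂ)
    (hb : ∀ α β, ηinv α β ≠ 0 → b α + b β = 1)
    (c : Pt N) (C : Matrix (Fin N) (Fin N) ℂ) (hC : C.IsSymm)
    (F0 F1 : Pt N → ℂ)
    (hF0 : ∀ t, AnalyticAt ℂ F0 t) (hF1 : ∀ t, AnalyticAt ℂ F1 t)
    (hid : ∀ v : VF N, qp F0 ηinv (bas 0) v = v)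
    (hwdvv : ∀ u v w : VF N,
      qp F0 ηinv (qp F0 ηinv u v) w = qp F0 ηinv u (qp F0 ηinv v w))
    (hqh0 : ∀ t, fderiv ℂ F0 t (euler c b (b 0) t)
      = 2 * (b 0 + 1) * F0 t + (1/2) * ∑ α, ∑ β, C α β * t α * t β)
    (hqh1 : ∃ k : ℂ, ∀ t, fderiv ℂ F1 t (euler c b (b 0) t) = k)
    (hGetzler : ∀ (v : Fin 4 → VF N) (t : Pt N),
      G0func F0 ηinv v t + G1func F0 F1 ηinv v t = 0) :
    ∀ t : Pt N,
      dirD (qvol F0 ηinv)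
        (fun s =>
          corr F1 [qp F0 ηinv (euler c b (b 0)) (euler c b (b 0))] s
          + (1/24) * ∑ α, corr F0
              [euler c b (b 0), euler c b (b 0), bas α, dua ηinv α] s
          - (1/2) * ∑ α, (b α * (1 - b α) - (b 0 + 1) / 6) *
              corr F0 [bas α, dua ηinv α] s) t = 0 := by
  intro t
  set e := euler c b (b 0) with he
  set P := gwPoint hηsym hη1 hb hF0 hF1 hwdvv hqh0 hqh1 t with hP
  have hE : Differentiable ℂ e := differentiable_euler c b (b 0)
  have hc := @differentiable_cvf N
  have hΔ : qvol F0 ηinv t = P.Δ := qvol_eq P rfl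
  have hE' : fderiv ℂ e t P.Δ = (P.b1 + 1) • P.Δ - P.G P.Δ := by
    rw [he, fderiv_euler]
    ext α
    change _ = (b 0 + 1) * P.Δ α - b α * P.Δ α
    ring
  have hsum : ∑ α, P.genusZero ![P.E, P.E, P.δ α, P.γ α] +
      ∑ α, P.genusOne ![P.E, P.E, P.δ α, P.γ α] = 0 := by
    rw [← Finset.sum_add_distrib]
    refine Finset.sum_eq_zero fun α _ => ?_
    have h := hGetzler ![e, e, dua ηinv α, bas α] t
    rw [show ηinv = P.ηinv from rfl, G0func_eq P rfl rfl rfl, G1func_eq P rfl rfl rfl rfl] at h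
    convert h using 3 <;> ext i <;> fin_cases i <;> rfl
  have hq := differentiable_qp hF0 ηinv hE hE
  have d1 : DifferentiableAt ℂ (corr F1 [qp F0 ηinv e e]) t :=
    differentiable_corr hF1 (by simp [hq]) t
  have d2 (α) : DifferentiableAt ℂ (corr F0 [e, e, bas α, dua ηinv α]) t :=
    differentiable_corr hF0 (by simp [hE, bas, dua, hc]) t
  have d3 (α) : DifferentiableAt ℂ (corr F0 [bas α, dua ηinv α]) t :=
    differentiable_corr hF0 (by simp [bas, dua, hc]) t
  have d4 := DifferentiableAt.fun_sum (u := Finset.univ) fun α _ => d2 α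
  have d5 := DifferentiableAt.fun_sum (u := Finset.univ) fun α _ =>
    (d3 α).const_mul (b α * (1 - b α) - (b 0 + 1) / 6)
  have h1 : fderiv ℂ (corr F1 [qp F0 ηinv e e]) t P.Δ = P.f2 (P.m P.E P.E) P.Δ +
      P.f1 (P.D P.E P.E P.Δ + (2 : ℂ) • P.m ((P.b1 + 1) • P.Δ - P.G P.Δ) P.E) := by
    rw [fderiv_corr_one hF1 hq, fderiv_qp hF0 ηinv hE hE, hE', qp_apply]
    change P.f1 (P.m _ P.E + P.m P.E _ + P.D P.Δ P.E P.E) + P.f2 (P.m P.E P.E) P.Δ = _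
    rw [P.m_comm P.E, ← two_smul ℂ, P.D_12, P.D_23, add_comm, add_comm (P.D _ _ _)]
  have h2 (α) : fderiv ℂ (corr F0 [e, e, bas α, dua ηinv α]) t P.Δ =
      P.c5 P.E P.E (P.γ α) (P.δ α) P.Δ +
        2 * P.c4 ((P.b1 + 1) • P.Δ - P.G P.Δ) P.E (P.γ α) (P.δ α) := by
    rw [bas, dua, fderiv_corr_four hF0 hE hE (hc _) (hc _), hE', fderiv_cvf, fderiv_cvf]
    simp only [map_zero, LinearMap.zero_apply, add_zero]
    change P.c4 _ P.E (P.γ α) (P.δ α) + P.c4 P.E _ (P.γ α) (P.δ α)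
      + P.c5 P.E P.E (P.γ α) (P.δ α) P.Δ = _
    rw [P.c4_12 P.E]
    ring
  have h3 (α) : fderiv ℂ (corr F0 [bas α, dua ηinv α]) t P.Δ = P.c3 (P.γ α) (P.δ α) P.Δ := by
    rw [bas, dua, fderiv_corr_two hF0 (hc _) (hc _), fderiv_cvf, fderiv_cvf]
    simp only [map_zero, LinearMap.zero_apply, zero_add]
    rfl
  rw [P.sum_genusZero, P.sum_genusOne, ← h1] at hsum
  simp only [← h2, ← h3] at hsum
  rw [dirD, hΔ, fderiv_fun_sub (d1.fun_add (d4.const_mul _)) (d5.const_mul _),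
    fderiv_fun_add d1 (d4.const_mul _), fderiv_const_mul d4, fderiv_const_mul d5,
    fderiv_fun_sum fun α _ => d2 α, fderiv_fun_sum fun α _ => (d3 α).const_mul _]
  simp only [fderiv_const_mul (d3 _), sub_apply, add_apply, smul_apply, sum_apply, smul_eq_mul]
  change _ - 12 * ∑ α, (b α * (1 - b α) - (b 0 + 1) / 6) * _ + _ = _ at hsum
  linear_combination (1 / 24) * hsum
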